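/- arXiv:2602.19251 — 10 statements merged into one kernel-verified Lean document; each statement's English description precedes it below -/
import Mathlib

section
/- Let U ⊆ ℂ be open, let f : U → ℂ be holomorphic with Im f(w) > 0 for every w ∈ U, and let y₀ ∈ ℝ with (y₀ : ℂ) ∈ U. Then there exist an open neighbourhood Ω of (0, y₀) in ℝ² and a C¹ function λ : Ω → ℂ such that for every (x,y) ∈ Ω one has y − λ(x,y)·x ∈ U, λ(x,y) = f(y − λ(x,y)·x), and Im λ(x,y) > 0; moreover λ(0,y₀) = f(y₀), and any continuous function λ' on Ω satisfying the same implicit equation with λ'(0,y₀) = f(y₀) agrees with λ on some neighbourhood of (0,y₀). -/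
/-- Local existence and uniqueness of the Burgers transform. -/
theorem stmt_0 (U : Set ℂ) (hU : IsOpen U) (f : ℂ → ℂ)
    (hf : DifferentiableOn ℂ f U) (hfim : ∀ w ∈ U, 0 < (f w).im)
    (y₀ : ℝ) (hy₀ : (y₀ : ℂ) ∈ U) :
    ∃ (Ω : Set (ℝ × ℝ)) (lam : ℝ × ℝ → ℂ),
      IsOpen Ω ∧ ((0 : ℝ), y₀) ∈ Ω ∧ ContDiffOn ℝ 1 lam Ω ∧
      (∀ p ∈ Ω, ((p.2 : ℂ) - lam p * (p.1 : ℂ)) ∈ U ∧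
        lam p = f ((p.2 : ℂ) - lam p * (p.1 : ℂ)) ∧ 0 < (lam p).im) ∧
      lam ((0 : ℝ), y₀) = f (y₀ : ℂ) ∧
      (∀ lam' : ℝ × ℝ → ℂ, ContinuousOn lam' Ω →
        (∀ p ∈ Ω, ((p.2 : ℂ) - lam' p * (p.1 : ℂ)) ∈ U ∧
          lam' p = f ((p.2 : ℂ) - lam' p * (p.1 : ℂ))) →
        lam' ((0 : ℝ), y₀) = f (y₀ : ℂ) →
        ∃ V : Set (ℝ × ℝ), IsOpen V ∧ ((0 : ℝ), y₀) ∈ V ∧ Set.EqOn lam' lam V) := by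
  set F : (ℝ × ℝ) × ℂ → ℂ := fun q => q.2 - f ((q.1.2 : ℂ) - q.2 * (q.1.1 : ℂ)) with hF
  set u : (ℝ × ℝ) × ℂ := (((0 : ℝ), y₀), f (y₀ : ℂ)) with hu
  have h_arg : ContDiff ℝ 1 (fun q : (ℝ × ℝ) × ℂ => (q.1.2 : ℂ) - q.2 * (q.1.1 : ℂ)) := by
    have h_cast : ContDiff ℝ 1 (fun x : ℝ => (x : ℂ)) := Complex.ofRealCLM.contDiff
    exact (h_cast.comp (contDiff_snd.comp contDiff_fst)).sub
      (contDiff_snd.mul (h_cast.comp (contDiff_fst.comp contDiff_fst)))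
  have hFu : F u = 0 := by simp [hF, hu]
  have hF_contDiff : ContDiffAt ℝ 1 F u := by
    have hf_contDiff : ContDiffAt ℝ 1 f ((u.1.2 : ℂ) - u.2 * (u.1.1 : ℂ)) := by
      have h : ContDiffAt ℂ 1 f (y₀ : ℂ) := (hf.analyticAt (hU.mem_nhds hy₀)).contDiffAt
      simpa [hu] using h.restrict_scalars ℝ
    exact contDiffAt_snd.sub (hf_contDiff.comp u h_arg.contDiffAt)
  have h_inr : fderiv ℝ F u ∘L .inr ℝ (ℝ × ℝ) ℂ = .id ℝ ℂ := by
    have h₁ : HasFDerivAt (fun z : ℂ => F (((0 : ℝ), y₀), z))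
        (fderiv ℝ F u ∘L .inr ℝ (ℝ × ℝ) ℂ) (f (y₀ : ℂ)) :=
      (hF_contDiff.differentiableAt one_ne_zero).hasFDerivAt.comp (f (y₀ : ℂ))
        (hasFDerivAt_prodMk_right ((0 : ℝ), y₀) (f (y₀ : ℂ)))
    have h₂ : HasFDerivAt (fun z : ℂ => F (((0 : ℝ), y₀), z)) (.id ℝ ℂ) (f (y₀ : ℂ)) := by
      simpa [hF] using (hasFDerivAt_id (𝕜 := ℝ) (f (y₀ : ℂ))).sub_const (f (y₀ : ℂ))
    exact h₁.unique h₂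
  have h_inv : (fderiv ℝ F u ∘L .inr ℝ (ℝ × ℝ) ℂ).IsInvertible := by
    rw [h_inr]
    exact ⟨.refl ℝ ℂ, rfl⟩
  set lam := hF_contDiff.implicitFunction one_ne_zero h_inv
  have hlam_base : lam ((0 : ℝ), y₀) = f (y₀ : ℂ) :=
    hF_contDiff.implicitFunction_apply_self one_ne_zero h_inv
  have hlam_contDiff : ContDiffAt ℝ 1 lam ((0 : ℝ), y₀) :=
    hF_contDiff.contDiffAt_implicitFunction one_ne_zero h_inv
  have h_eq : ∀ᶠ p in nhds ((0 : ℝ), y₀), F (p, lam p) = F u :=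
    hF_contDiff.eventually_apply_implicitFunction one_ne_zero h_inv
  have h_mem : ∀ᶠ p in nhds ((0 : ℝ), y₀), (p.2 : ℂ) - lam p * (p.1 : ℂ) ∈ U := by
    have h_cont : ContinuousAt (fun p : ℝ × ℝ => (p.2 : ℂ) - lam p * (p.1 : ℂ)) ((0 : ℝ), y₀) :=
      h_arg.continuous.continuousAt.comp (continuousAt_id.prodMk hlam_contDiff.continuousAt)
    exact h_cont.eventually_mem (hU.mem_nhds (by simpa using hy₀))
  obtain ⟨Ω, hΩ, hΩ_open, hΩ_base⟩ := eventually_nhds_iff.1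
    ((hlam_contDiff.eventually (by simp)).and (h_eq.and h_mem))
  refine ⟨Ω, lam, hΩ_open, hΩ_base, fun p hp => (hΩ p hp).1.contDiffWithinAt, fun p hp => ?_,
    hlam_base, fun lam' hlam'_cont hlam'_eq hlam'_base => ?_⟩
  · obtain ⟨-, hp_eq, hp_mem⟩ := hΩ p hp
    have hp_fix : lam p = f ((p.2 : ℂ) - lam p * (p.1 : ℂ)) := sub_eq_zero.1 (hp_eq.trans hFu)
    exact ⟨hp_mem, hp_fix, hp_fix ▸ hfim _ hp_mem⟩
  · have h_tendsto : Filter.Tendsto (fun p => (p, lam' p)) (nhds ((0 : ℝ), y₀)) (nhds u) := by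
      have h := continuousAt_id.prodMk (hlam'_cont.continuousAt (hΩ_open.mem_nhds hΩ_base))
      simpa [ContinuousAt, hlam'_base] using h
    have h_unique := h_tendsto.eventually
      (hF_contDiff.eventually_apply_eq_iff_implicitFunction one_ne_zero h_inv)
    obtain ⟨V, hV, hV_open, hV_base⟩ := eventually_nhds_iff.1
      (h_unique.and (hΩ_open.mem_nhds hΩ_base))
    refine ⟨V, hV_open, hV_base, fun p hp => ?_⟩
    obtain ⟨hp_iff, hp_mem⟩ := hV p hp
    exact (hp_iff.1 ((sub_eq_zero.2 (hlam'_eq p hp_mem).2).trans hFu.symm)).symm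
end

section
/- Let U ⊆ ℂ be open, let f : U → ℂ be holomorphic, let Ω ⊆ ℝ² be open, and let λ : Ω → ℂ be differentiable (in the real sense). Suppose that for every (x,y) ∈ Ω, setting w = y − λ(x,y)·x, one has w ∈ U, λ(x,y) = f(w), and 1 + f'(w)·x ≠ 0. Then λ satisfies the conservative complex Burgers equation λ_x + λ·λ_y = 0 on Ω, where λ_x and λ_y denote the partial derivatives of λ in the directions (1,0) and (0,1). -/
/-- A holomorphic seed produces a solution of the conservative
complex Burgers equation wherever the characteristic Jacobian is nonzero. -/
theorem stmt_1 (U : Set ℂ) (hU : IsOpen U) (f : ℂ → ℂ)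
    (hf : DifferentiableOn ℂ f U)
    (Ω : Set (ℝ × ℝ)) (hΩ : IsOpen Ω) (lam : ℝ × ℝ → ℂ)
    (hdiff : ∀ p ∈ Ω, DifferentiableAt ℝ lam p)
    (himp : ∀ p ∈ Ω, ((p.2 : ℂ) - lam p * (p.1 : ℂ)) ∈ U ∧
      lam p = f ((p.2 : ℂ) - lam p * (p.1 : ℂ)) ∧
      1 + deriv f ((p.2 : ℂ) - lam p * (p.1 : ℂ)) * (p.1 : ℂ) ≠ 0) :
    ∀ p ∈ Ω, fderiv ℝ lam p (1, 0) + lam p * fderiv ℝ lam p (0, 1) = 0 := by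
  intro p hp
  obtain ⟨hU', -, hJ⟩ := himp p hp
  have hL : HasFDerivAt lam (fderiv ℝ lam p) p := (hdiff p hp).hasFDerivAt
  have hx : HasFDerivAt (fun q : ℝ × ℝ => (q.1 : ℂ))
      (Complex.ofRealCLM.comp (ContinuousLinearMap.fst ℝ ℝ ℝ)) p :=
    (Complex.ofRealCLM.comp (ContinuousLinearMap.fst ℝ ℝ ℝ)).hasFDerivAt
  have hy : HasFDerivAt (fun q : ℝ × ℝ => (q.2 : ℂ))
      (Complex.ofRealCLM.comp (ContinuousLinearMap.snd ℝ ℝ ℝ)) p :=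
    (Complex.ofRealCLM.comp (ContinuousLinearMap.snd ℝ ℝ ℝ)).hasFDerivAt
  have hw := hy.sub (hL.mul hx)
  have hf' := ((hf.differentiableAt (hU.mem_nhds hU')).hasDerivAt.hasFDerivAt).restrictScalars ℝ
  have hcomp := HasFDerivAt.comp p hf' hw
  have heq := (hcomp.congr_of_eventuallyEq (f₁ := lam) (by
    filter_upwards [hΩ.mem_nhds hp] with q hq using (himp q hq).2.1)).unique hL
  have h₁ := DFunLike.congr_fun heq (1, 0)
  have h₂ := DFunLike.congr_fun heq (0, 1)
  simp at h₁ h₂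
  refine (mul_eq_zero.mp ?_).resolve_left hJ
  linear_combination -h₁ - lam p * h₂
end

section
/- Let U ⊆ ℂ be open, let f : U → ℂ be continuously differentiable in the real sense, let I be a nonempty open interval of ℝ with I ⊆ U, let Ω ⊆ ℝ² be open with {0} × I ⊆ Ω, and let λ : Ω → ℂ be C¹ satisfying λ(x,y) = f(y − λ(x,y)·x) with y − λ(x,y)·x ∈ U for all (x,y) ∈ Ω. Then for every y ∈ I, the transport obstruction at x = 0 satisfies λ_x(0,y) + λ(0,y)·λ_y(0,y) = 2·i·(Im f(y))·f_w̄(y). -/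
/-- Obstruction formula at x = 0:
H|₍ₓ₌₀₎ = 2i (Im f) f_w̄. -/
theorem stmt_4 (U : Set ℂ) (hU : IsOpen U) (f : ℂ → ℂ)
    (hf : ContDiffOn ℝ 1 f U)
    (a b : ℝ) (hab : a < b) (hIU : ∀ y ∈ Set.Ioo a b, (y : ℂ) ∈ U)
    (Ω : Set (ℝ × ℝ)) (hΩ : IsOpen Ω)
    (hIΩ : ∀ y ∈ Set.Ioo a b, ((0 : ℝ), y) ∈ Ω)
    (lam : ℝ × ℝ → ℂ) (hlam : ContDiffOn ℝ 1 lam Ω)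
    (himp : ∀ p ∈ Ω, ((p.2 : ℂ) - lam p * (p.1 : ℂ)) ∈ U ∧
      lam p = f ((p.2 : ℂ) - lam p * (p.1 : ℂ))) :
    ∀ y ∈ Set.Ioo a b,
      fderiv ℝ lam ((0 : ℝ), y) (1, 0) +
          lam ((0 : ℝ), y) * fderiv ℝ lam ((0 : ℝ), y) (0, 1) =
        2 * Complex.I * ((f (y : ℂ)).im : ℂ) *
          ((1 / 2 : ℂ) *
            (fderiv ℝ f (y : ℂ) 1 + Complex.I * fderiv ℝ f (y : ℂ) Complex.I)) := by
  intro y hy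
  have hp : ((0 : ℝ), y) ∈ Ω := hIΩ y hy
  have hlam_eq : lam (0, y) = f y := by simpa using (himp _ hp).2
  have hf' : HasFDerivAt f (fderiv ℝ f (y : ℂ)) (y : ℂ) :=
    ((hf.differentiableOn one_ne_zero).differentiableAt
      (hU.mem_nhds (hIU y hy))).hasFDerivAt
  have hlam' : HasFDerivAt lam (fderiv ℝ lam (0, y)) (0, y) :=
    ((hlam.differentiableOn one_ne_zero).differentiableAt (hΩ.mem_nhds hp)).hasFDerivAt
  have hfst : HasFDerivAt (fun p : ℝ × ℝ => (p.1 : ℂ))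
      (Complex.ofRealCLM.comp (ContinuousLinearMap.fst ℝ ℝ ℝ)) (0, y) :=
    (Complex.ofRealCLM.comp (ContinuousLinearMap.fst ℝ ℝ ℝ)).hasFDerivAt
  have hsnd : HasFDerivAt (fun p : ℝ × ℝ => (p.2 : ℂ))
      (Complex.ofRealCLM.comp (ContinuousLinearMap.snd ℝ ℝ ℝ)) (0, y) :=
    (Complex.ofRealCLM.comp (ContinuousLinearMap.snd ℝ ℝ ℝ)).hasFDerivAt
  have hg := hsnd.sub (hlam'.mul hfst)
  have hcomp := HasFDerivAt.comp (g := f) (g' := fderiv ℝ f (y : ℂ)) (0, y)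
    (by simpa using hf') hg
  have heq : lam =ᶠ[nhds ((0 : ℝ), y)]
      fun p => f ((p.2 : ℂ) - lam p * (p.1 : ℂ)) :=
    Filter.eventuallyEq_of_mem (hΩ.mem_nhds hp) fun p hp => (himp p hp).2
  have hfderiv := (hcomp.congr_of_eventuallyEq heq).fderiv
  have hx : fderiv ℝ lam (0, y) (1, 0) = fderiv ℝ f (y : ℂ) (-f y) := by
    rw [hfderiv]
    simp [hlam_eq]
  have hy' : fderiv ℝ lam (0, y) (0, 1) = fderiv ℝ f (y : ℂ) 1 := by
    rw [hfderiv]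
    simp
  have hdecomp : -f y = (-(f y).re) • (1 : ℂ) + (-(f y).im) • Complex.I := by
    apply Complex.ext <;> simp
  have hneg : fderiv ℝ f (y : ℂ) (-f y) =
      -((f y).re : ℂ) * fderiv ℝ f (y : ℂ) 1 -
        ((f y).im : ℂ) * fderiv ℝ f (y : ℂ) Complex.I := by
    rw [hdecomp, map_add, map_smul, map_smul, Complex.real_smul, Complex.real_smul]
    push_cast
    ring
  rw [hx, hy', hlam_eq, hneg]
  linear_combination
    (-fderiv ℝ f (y : ℂ) 1) * Complex.re_add_im (f y) -
      ((f y).im : ℂ) * fderiv ℝ f (y : ℂ) Complex.I * Complex.I_sq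
end

section
/- Let U ⊆ ℂ be open, let f : U → ℂ be continuously differentiable in the real sense, let Ω ⊆ ℝ² be open, and let λ : Ω → ℂ be C¹ satisfying λ(x,y) = f(y − λ(x,y)·x) with y − λ(x,y)·x ∈ U for all (x,y) ∈ Ω. Fix (x,y) ∈ Ω, set w = y − λ(x,y)·x, H = λ_x + λ·λ_y and P = (conj λ)_x + λ·(conj λ)_y (evaluated at (x,y), where conj λ denotes the pointwise complex conjugate of λ). Then H·(1 + f_w(w)·x) = f_w̄(w)·((λ − conj λ) − x·P), and P·(1 + x·conj(f_w(w))) = 2·i·(Im λ)·conj(f_w(w)) − x·conj(f_w̄(w))·H. -/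
/-- A real-linear map on `ℂ` in terms of its complex-linear and conjugate-linear parts. -/
theorem ContinuousLinearMap.apply_eq_wirtinger (L : ℂ →L[ℝ] ℂ) (v : ℂ) :
    L v = (1 / 2 : ℂ) * (L 1 - Complex.I * L Complex.I) * v +
      (1 / 2 : ℂ) * (L 1 + Complex.I * L Complex.I) * (starRingEnd ℂ) v := by
  have hv : v = v.re • (1 : ℂ) + v.im • Complex.I := by
    simp [Complex.re_add_im]
  have hL : L v = v.re * L 1 + v.im * L Complex.I := by
    conv_lhs => rw [hv]
    rw [map_add, map_smul, map_smul, Complex.real_smul, Complex.real_smul]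
  have hadd : v + (starRingEnd ℂ) v = 2 * v.re := by
    rw [Complex.add_conj]; push_cast; ring
  have hsub : v - (starRingEnd ℂ) v = 2 * v.im * Complex.I := by
    rw [Complex.sub_conj]; push_cast; ring
  rw [hL]
  linear_combination (-1 / 2 : ℂ) * L 1 * hadd + (1 / 2 : ℂ) * Complex.I * L Complex.I * hsub +
    (v.im : ℂ) * L Complex.I * Complex.I_mul_I

/-- The directional derivative of the implicit relation `lam q = f (q.2 - lam q * q.1)`. -/
theorem fderiv_apply_of_implicit {f : ℂ → ℂ} {lam : ℝ × ℝ → ℂ} {p : ℝ × ℝ}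
    (hf : DifferentiableAt ℝ f ((p.2 : ℂ) - lam p * (p.1 : ℂ)))
    (hlam : DifferentiableAt ℝ lam p)
    (himp : ∀ᶠ q in nhds p, lam q = f ((q.2 : ℂ) - lam q * (q.1 : ℂ))) (v : ℝ × ℝ) :
    fderiv ℝ lam p v = fderiv ℝ f ((p.2 : ℂ) - lam p * (p.1 : ℂ))
      ((v.2 : ℂ) - (lam p * (v.1 : ℂ) + fderiv ℝ lam p v * (p.1 : ℂ))) := by
  have hfst : HasFDerivAt (fun q : ℝ × ℝ => (q.1 : ℂ))
      (Complex.ofRealCLM.comp (ContinuousLinearMap.fst ℝ ℝ ℝ)) p :=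
    (Complex.ofRealCLM.comp (ContinuousLinearMap.fst ℝ ℝ ℝ)).hasFDerivAt
  have hsnd : HasFDerivAt (fun q : ℝ × ℝ => (q.2 : ℂ))
      (Complex.ofRealCLM.comp (ContinuousLinearMap.snd ℝ ℝ ℝ)) p :=
    (Complex.ofRealCLM.comp (ContinuousLinearMap.snd ℝ ℝ ℝ)).hasFDerivAt
  have hg := hsnd.sub (hlam.hasFDerivAt.mul hfst)
  have hcomp := (HasFDerivAt.comp p hf.hasFDerivAt hg).congr_of_eventuallyEq himp
  have h := DFunLike.congr_fun hcomp.fderiv v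
  simpa [mul_comm] using h


/-- The coupled obstruction identities at a general point. -/
theorem stmt_5 (U : Set ℂ) (hU : IsOpen U) (f : ℂ → ℂ) (hf : ContDiffOn ℝ 1 f U)
    (Ω : Set (ℝ × ℝ)) (hΩ : IsOpen Ω) (lam : ℝ × ℝ → ℂ)
    (hlam : ContDiffOn ℝ 1 lam Ω)
    (himp : ∀ p ∈ Ω, ((p.2 : ℂ) - lam p * (p.1 : ℂ)) ∈ U ∧
      lam p = f ((p.2 : ℂ) - lam p * (p.1 : ℂ)))
    (p : ℝ × ℝ) (hp : p ∈ Ω) :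
    let w : ℂ := (p.2 : ℂ) - lam p * (p.1 : ℂ)
    let fw : ℂ := (1 / 2 : ℂ) * (fderiv ℝ f w 1 - Complex.I * fderiv ℝ f w Complex.I)
    let fwbar : ℂ := (1 / 2 : ℂ) * (fderiv ℝ f w 1 + Complex.I * fderiv ℝ f w Complex.I)
    let H : ℂ := fderiv ℝ lam p (1, 0) + lam p * fderiv ℝ lam p (0, 1)
    let P : ℂ := fderiv ℝ (fun q => (starRingEnd ℂ) (lam q)) p (1, 0) +
      lam p * fderiv ℝ (fun q => (starRingEnd ℂ) (lam q)) p (0, 1)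
    H * (1 + fw * (p.1 : ℂ)) =
        fwbar * ((lam p - (starRingEnd ℂ) (lam p)) - (p.1 : ℂ) * P) ∧
      P * (1 + (p.1 : ℂ) * (starRingEnd ℂ) fw) =
        2 * Complex.I * ((lam p).im : ℂ) * (starRingEnd ℂ) fw -
          (p.1 : ℂ) * (starRingEnd ℂ) fwbar * H := by
  intro w fw fwbar H P
  have hfd : DifferentiableAt ℝ f w :=
    (hf.contDiffAt (hU.mem_nhds (himp p hp).1)).differentiableAt one_ne_zero
  have hld : DifferentiableAt ℝ lam p :=
    (hlam.contDiffAt (hΩ.mem_nhds hp)).differentiableAt one_ne_zero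
  have hev : ∀ᶠ q in nhds p, lam q = f ((q.2 : ℂ) - lam q * (q.1 : ℂ)) := by
    filter_upwards [hΩ.mem_nhds hp] with q hq using (himp q hq).2
  have hconj (v : ℝ × ℝ) : fderiv ℝ (fun q => (starRingEnd ℂ) (lam q)) p v =
      (starRingEnd ℂ) (fderiv ℝ lam p v) := by
    have h := Complex.conjCLE.toContinuousLinearMap.hasFDerivAt.comp p hld.hasFDerivAt
    exact DFunLike.congr_fun h.fderiv v
  have hD (v : ℝ × ℝ) : fderiv ℝ lam p v =
      fw * ((v.2 : ℂ) - (lam p * (v.1 : ℂ) + fderiv ℝ lam p v * (p.1 : ℂ))) +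
        fwbar * ((v.2 : ℂ) - ((starRingEnd ℂ) (lam p) * (v.1 : ℂ) +
          (starRingEnd ℂ) (fderiv ℝ lam p v) * (p.1 : ℂ))) := by
    have h := (fderiv_apply_of_implicit hfd hld hev v).trans
      (ContinuousLinearMap.apply_eq_wirtinger _ _)
    simpa only [map_sub, map_add, map_mul, Complex.conj_ofReal] using h
  have hx := hD (1, 0)
  have hy := hD (0, 1)
  have hx' := congrArg (starRingEnd ℂ) hx
  have hy' := congrArg (starRingEnd ℂ) hy
  simp only [map_sub, map_add, map_mul, Complex.conj_ofReal, Complex.conj_conj,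
    Complex.ofReal_one, Complex.ofReal_zero, map_one, map_zero] at hx hy hx' hy'
  have him : lam p - (starRingEnd ℂ) (lam p) = 2 * Complex.I * ((lam p).im : ℂ) := by
    rw [Complex.sub_conj]; push_cast; ring
  simp only [H, P, hconj]
  constructor
  · linear_combination hx + lam p * hy
  · linear_combination hx' + lam p * hy' + (starRingEnd ℂ) fw * him
end

section
/- Let U ⊆ ℂ be open, let f : U → ℂ be continuously differentiable in the real sense with Im f(w) > 0 for all w ∈ U, let I be a nonempty open interval of ℝ with I ⊆ U, let Ω ⊆ ℝ² be open with {0} × I ⊆ Ω, and let λ : Ω → ℂ be C¹ satisfying λ(x,y) = f(y − λ(x,y)·x) with y − λ(x,y)·x ∈ U and Im λ(x,y) > 0 for all (x,y) ∈ Ω. Define μ : Ω → ℂ by μ = (λ − i)/(λ + i). Then for every y ∈ I, the Poincaré residual at (0,y) satisfies μ_z̄(0,y) − μ(0,y)·μ_z(0,y) = (−4·i·(Im f(y))·f_w̄(y))/(f(y) + i)³, where μ_z = (1/2)(μ_x − i·μ_y) and μ_z̄ = (1/2)(μ_x + i·μ_y). -/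
/-- At `x = 0`, a solution of the implicit equation `lam = f (y - lam x)` has derivative
`(p₁, p₂) ↦ Df(y) (p₂ - lam p₁)`. -/
lemma fderiv_of_implicit {Ω : Set (ℝ × ℝ)} (hΩ : IsOpen Ω) {f : ℂ → ℂ} {lam : ℝ × ℝ → ℂ} {y : ℝ}
    (hy : ((0 : ℝ), y) ∈ Ω) (hf : DifferentiableAt ℝ f (y : ℂ))
    (hlam : DifferentiableAt ℝ lam ((0 : ℝ), y))
    (himp : ∀ p ∈ Ω, lam p = f ((p.2 : ℂ) - lam p * (p.1 : ℂ))) (v : ℝ × ℝ) :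
    fderiv ℝ lam ((0 : ℝ), y) v
      = fderiv ℝ f (y : ℂ) ((v.2 : ℂ) - lam ((0 : ℝ), y) * (v.1 : ℂ)) := by
  have h₁ : HasFDerivAt (fun p : ℝ × ℝ => (p.1 : ℂ))
      (Complex.ofRealCLM.comp (ContinuousLinearMap.fst ℝ ℝ ℝ)) ((0 : ℝ), y) :=
    (Complex.ofRealCLM.comp (ContinuousLinearMap.fst ℝ ℝ ℝ)).hasFDerivAt
  have h₂ : HasFDerivAt (fun p : ℝ × ℝ => (p.2 : ℂ))
      (Complex.ofRealCLM.comp (ContinuousLinearMap.snd ℝ ℝ ℝ)) ((0 : ℝ), y) :=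
    (Complex.ofRealCLM.comp (ContinuousLinearMap.snd ℝ ℝ ℝ)).hasFDerivAt
  have hg := h₂.sub (hlam.hasFDerivAt.mul h₁)
  have hf' : HasFDerivAt f (fderiv ℝ f (y : ℂ))
      (((fun p : ℝ × ℝ => (p.2 : ℂ)) - lam * fun p : ℝ × ℝ => (p.1 : ℂ)) ((0 : ℝ), y)) := by
    simpa using hf.hasFDerivAt
  have hcomp := hf'.comp ((0 : ℝ), y) hg
  have heq : lam =ᶠ[nhds ((0 : ℝ), y)]
      f ∘ ((fun p : ℝ × ℝ => (p.2 : ℂ)) - lam * fun p : ℝ × ℝ => (p.1 : ℂ)) := by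
    filter_upwards [hΩ.mem_nhds hy] with p hp using himp p hp
  rw [(hcomp.congr_of_eventuallyEq heq).fderiv]
  simp

/-- The derivative of the Cayley transform `(lam - i) / (lam + i)` is `2 i lam' / (lam + i)²`. -/
lemma fderiv_cayley {E : Type*} [NormedAddCommGroup E] [NormedSpace ℝ E] {lam : E → ℂ} {p : E}
    (hlam : DifferentiableAt ℝ lam p) (hp : lam p + Complex.I ≠ 0) (v : E) :
    fderiv ℝ (fun q => (lam q - Complex.I) / (lam q + Complex.I)) p v
      = 2 * Complex.I * fderiv ℝ lam p v / (lam p + Complex.I) ^ 2 := by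
  have hc : HasDerivAt (fun w : ℂ => (w - Complex.I) / (w + Complex.I))
      (2 * Complex.I / (lam p + Complex.I) ^ 2) (lam p) := by
    refine (((hasDerivAt_id' (lam p)).sub_const Complex.I).div
      ((hasDerivAt_id' (lam p)).add_const Complex.I) hp).congr_deriv ?_
    ring
  have h := (hc.hasFDerivAt.restrictScalars ℝ).comp p hlam.hasFDerivAt
  rw [show (fun q => (lam q - Complex.I) / (lam q + Complex.I))
    = (fun w : ℂ => (w - Complex.I) / (w + Complex.I)) ∘ lam from rfl, h.fderiv]
  simp
  ring

/-- Poincaré residual formula at x = 0. -/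
theorem stmt_8 (U : Set ℂ) (hU : IsOpen U) (f : ℂ → ℂ) (hf : ContDiffOn ℝ 1 f U)
    (hfim : ∀ w ∈ U, 0 < (f w).im)
    (a b : ℝ) (hab : a < b) (hIU : ∀ y ∈ Set.Ioo a b, (y : ℂ) ∈ U)
    (Ω : Set (ℝ × ℝ)) (hΩ : IsOpen Ω)
    (hIΩ : ∀ y ∈ Set.Ioo a b, ((0 : ℝ), y) ∈ Ω)
    (lam : ℝ × ℝ → ℂ) (hlam : ContDiffOn ℝ 1 lam Ω)
    (himp : ∀ p ∈ Ω, ((p.2 : ℂ) - lam p * (p.1 : ℂ)) ∈ U ∧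
      lam p = f ((p.2 : ℂ) - lam p * (p.1 : ℂ)) ∧ 0 < (lam p).im)
    (mu : ℝ × ℝ → ℂ)
    (hmu : ∀ p, mu p = (lam p - Complex.I) / (lam p + Complex.I)) :
    ∀ y ∈ Set.Ioo a b,
      ((1 / 2 : ℂ) *
          (fderiv ℝ mu ((0 : ℝ), y) (1, 0) +
            Complex.I * fderiv ℝ mu ((0 : ℝ), y) (0, 1))) -
        mu ((0 : ℝ), y) *
          ((1 / 2 : ℂ) *
            (fderiv ℝ mu ((0 : ℝ), y) (1, 0) -
              Complex.I * fderiv ℝ mu ((0 : ℝ), y) (0, 1))) =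
      (-4 * Complex.I * ((f (y : ℂ)).im : ℂ) *
          ((1 / 2 : ℂ) *
            (fderiv ℝ f (y : ℂ) 1 + Complex.I * fderiv ℝ f (y : ℂ) Complex.I))) /
        (f (y : ℂ) + Complex.I) ^ 3 := by
  intro y hy
  have hf' : DifferentiableAt ℝ f (y : ℂ) :=
    (hf.differentiableOn one_ne_zero).differentiableAt (hU.mem_nhds (hIU y hy))
  have hlam' : DifferentiableAt ℝ lam ((0 : ℝ), y) :=
    (hlam.differentiableOn one_ne_zero).differentiableAt (hΩ.mem_nhds (hIΩ y hy))
  have h₀ : lam ((0 : ℝ), y) = f (y : ℂ) := by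
    simpa using (himp _ (hIΩ y hy)).2.1
  have hne : f (y : ℂ) + Complex.I ≠ 0 := fun h => by
    have him := congrArg Complex.im h
    simp only [Complex.add_im, Complex.I_im, Complex.zero_im] at him
    linarith [hfim _ (hIU y hy)]
  have hD := fderiv_of_implicit hΩ (hIΩ y hy) hf' hlam' (fun p hp => (himp p hp).2.1)
  have hdx : fderiv ℝ f (y : ℂ) (-f (y : ℂ))
      = -((f (y : ℂ)).re * fderiv ℝ f (y : ℂ) 1
        + (f (y : ℂ)).im * fderiv ℝ f (y : ℂ) Complex.I) := by
    have hdec : -f (y : ℂ)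
        = -((f (y : ℂ)).re • (1 : ℂ) + (f (y : ℂ)).im • Complex.I) := by
      simp
    rw [hdec, map_neg, map_add, map_smul, map_smul, Complex.real_smul, Complex.real_smul]
  rw [hmu, funext hmu, fderiv_cayley hlam' (h₀ ▸ hne), fderiv_cayley hlam' (h₀ ▸ hne), hD, hD, h₀]
  simp only [Complex.ofReal_zero, Complex.ofReal_one, mul_zero, mul_one, zero_sub, sub_zero, hdx]
  generalize fderiv ℝ f (y : ℂ) 1 = d₁
  generalize fderiv ℝ f (y : ℂ) Complex.I = d₂
  have hre : ((f (y : ℂ)).re : ℂ) = f (y : ℂ) - (f (y : ℂ)).im * Complex.I :=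
    eq_sub_of_add_eq (Complex.re_add_im _)
  rw [hre]
  generalize ((f (y : ℂ)).im : ℂ) = t
  generalize f (y : ℂ) = l at hne ⊢
  field_simp
  ring_nf
  simp only [Complex.I_sq]
  ring_nf
end

section
/- Let U ⊆ ℂ be open, let f, h : U → ℂ be holomorphic, let ε₀ > 0, fix (x,y) ∈ ℝ², and let λ : (−ε₀, ε₀) → ℂ be a function, differentiable at ε = 0, such that for every ε ∈ (−ε₀, ε₀), setting w_ε = y − λ(ε)·x, one has w_ε ∈ U and λ(ε) = f(w_ε) + ε·h(w_ε). Set λ₀ = λ(0), w₀ = y − λ₀·x, and J = 1 + f'(w₀)·x, and assume J ≠ 0. Then the derivative of λ at ε = 0 equals h(w₀)/J. -/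
/-- The propagator formula 𝒫_f[h] = h(w₀)/J. -/
theorem stmt_9 (U : Set ℂ) (hU : IsOpen U) (f h : ℂ → ℂ)
    (hf : DifferentiableOn ℂ f U) (hh : DifferentiableOn ℂ h U)
    (ε₀ : ℝ) (hε₀ : 0 < ε₀) (x y : ℝ) (lam : ℝ → ℂ)
    (hdiff : DifferentiableAt ℝ lam 0)
    (himp : ∀ ε ∈ Set.Ioo (-ε₀) ε₀,
      ((y : ℂ) - lam ε * (x : ℂ)) ∈ U ∧
      lam ε = f ((y : ℂ) - lam ε * (x : ℂ)) +
        (ε : ℂ) * h ((y : ℂ) - lam ε * (x : ℂ)))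
    (hJ : 1 + deriv f ((y : ℂ) - lam 0 * (x : ℂ)) * (x : ℂ) ≠ 0) :
    deriv lam 0 =
      h ((y : ℂ) - lam 0 * (x : ℂ)) /
        (1 + deriv f ((y : ℂ) - lam 0 * (x : ℂ)) * (x : ℂ)) := by
  have hmem : (0 : ℝ) ∈ Set.Ioo (-ε₀) ε₀ := ⟨by linarith, hε₀⟩
  have hw : HasDerivAt (fun ε : ℝ ↦ (y : ℂ) - lam ε * (x : ℂ)) (-(deriv lam 0 * x)) 0 :=
    (hdiff.hasDerivAt.mul_const (x : ℂ)).const_sub (y : ℂ)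
  have hUw := hU.mem_nhds (himp 0 hmem).1
  have hfw := (hf.differentiableAt hUw).hasDerivAt.comp (0 : ℝ) hw
  have hhw := (hh.differentiableAt hUw).hasDerivAt.comp (0 : ℝ) hw
  have hrhs := hfw.add ((Complex.ofRealCLM.hasDerivAt (x := (0 : ℝ))).mul hhw)
  have heq := (hdiff.hasDerivAt.congr_of_eventuallyEq
    (Filter.eventually_of_mem (Ioo_mem_nhds hmem.1 hmem.2)
      fun ε hε ↦ (himp ε hε).2.symm)).unique hrhs
  simp only [Complex.ofRealCLM_apply, Complex.ofReal_zero, Complex.ofReal_one, zero_mul,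
    one_mul, add_zero, Function.comp_apply] at heq
  rw [eq_div_iff hJ]
  linear_combination heq
end

section
/- Let U ⊆ ℂ be open, let f, h₁, h₂ : U → ℂ be holomorphic, let ε₀ > 0, and fix (x,y) ∈ ℝ². Suppose λ¹, λ², λ¹² : (−ε₀, ε₀) → ℂ are differentiable at ε = 0, agree at ε = 0 with common value λ₀, and satisfy for every ε: λ¹(ε) = f(y − λ¹(ε)·x) + ε·h₁(y − λ¹(ε)·x), λ²(ε) = f(y − λ²(ε)·x) + ε·h₂(y − λ²(ε)·x), and λ¹²(ε) = f(y − λ¹²(ε)·x) + ε·h₁(y − λ¹²(ε)·x)·h₂(y − λ¹²(ε)·x), with all arguments y − λ·x lying in U. Set w₀ = y − λ₀·x and J = 1 + f'(w₀)·x, and assume J ≠ 0. Then, writing D¹, D², D¹² for the respective derivatives at ε = 0, one has D¹² = J·D¹·D² (Jacobian-twisted multiplicativity of the propagator). -/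
/-- Differentiating the implicit equation of the perturbed Burgers transform: the Jacobian times
the propagator value is the perturbation evaluated at the foot of the characteristic. -/
theorem jacobian_mul_deriv_eq_of_implicit {U : Set ℂ} (hU : IsOpen U) {f h : ℂ → ℂ}
    (hf : DifferentiableOn ℂ f U) (hh : DifferentiableOn ℂ h U)
    {ε₀ : ℝ} (hε₀ : 0 < ε₀) {x y : ℂ} {lam : ℝ → ℂ} (hd : DifferentiableAt ℝ lam 0)
    (himp : ∀ ε ∈ Set.Ioo (-ε₀) ε₀, y - lam ε * x ∈ U ∧
      lam ε = f (y - lam ε * x) + (ε : ℂ) * h (y - lam ε * x)) :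
    (1 + deriv f (y - lam 0 * x) * x) * deriv lam 0 = h (y - lam 0 * x) := by
  have hU0 : U ∈ nhds (y - lam 0 * x) :=
    hU.mem_nhds (himp 0 ⟨neg_lt_zero.mpr hε₀, hε₀⟩).1
  have hw : HasDerivAt (fun ε : ℝ => y - lam ε * x) (-(deriv lam 0 * x)) 0 :=
    (hd.hasDerivAt.mul_const x).const_sub y
  have hfw := (hf.differentiableAt hU0).hasDerivAt.comp (0 : ℝ) hw
  have hhw := (hh.differentiableAt hU0).hasDerivAt.comp (0 : ℝ) hw
  have hε : HasDerivAt (fun ε : ℝ => (ε : ℂ)) 1 0 := Complex.ofRealCLM.hasDerivAt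
  have heq : lam =ᶠ[nhds 0] fun ε : ℝ => f (y - lam ε * x) + (ε : ℂ) * h (y - lam ε * x) := by
    filter_upwards [Ioo_mem_nhds (neg_lt_zero.mpr hε₀) hε₀] with ε hmem
    exact (himp ε hmem).2
  have key := hd.hasDerivAt.unique ((hfw.add (hε.mul hhw)).congr_of_eventuallyEq heq)
  simp only [Function.comp_apply, Complex.ofReal_zero, zero_mul, add_zero, one_mul] at key
  linear_combination key

/-- Jacobian-twisted multiplicativity of the propagator. -/
theorem stmt_10 (U : Set ℂ) (hU : IsOpen U) (f h₁ h₂ : ℂ → ℂ)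
    (hf : DifferentiableOn ℂ f U) (hh₁ : DifferentiableOn ℂ h₁ U)
    (hh₂ : DifferentiableOn ℂ h₂ U)
    (ε₀ : ℝ) (hε₀ : 0 < ε₀) (x y : ℝ) (lam₁ lam₂ lam₁₂ : ℝ → ℂ)
    (hd₁ : DifferentiableAt ℝ lam₁ 0) (hd₂ : DifferentiableAt ℝ lam₂ 0)
    (hd₁₂ : DifferentiableAt ℝ lam₁₂ 0)
    (lam₀ : ℂ) (h0₁ : lam₁ 0 = lam₀) (h0₂ : lam₂ 0 = lam₀) (h0₁₂ : lam₁₂ 0 = lam₀)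
    (himp₁ : ∀ ε ∈ Set.Ioo (-ε₀) ε₀,
      ((y : ℂ) - lam₁ ε * (x : ℂ)) ∈ U ∧
      lam₁ ε = f ((y : ℂ) - lam₁ ε * (x : ℂ)) +
        (ε : ℂ) * h₁ ((y : ℂ) - lam₁ ε * (x : ℂ)))
    (himp₂ : ∀ ε ∈ Set.Ioo (-ε₀) ε₀,
      ((y : ℂ) - lam₂ ε * (x : ℂ)) ∈ U ∧
      lam₂ ε = f ((y : ℂ) - lam₂ ε * (x : ℂ)) +
        (ε : ℂ) * h₂ ((y : ℂ) - lam₂ ε * (x : ℂ)))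
    (himp₁₂ : ∀ ε ∈ Set.Ioo (-ε₀) ε₀,
      ((y : ℂ) - lam₁₂ ε * (x : ℂ)) ∈ U ∧
      lam₁₂ ε = f ((y : ℂ) - lam₁₂ ε * (x : ℂ)) +
        (ε : ℂ) * (h₁ ((y : ℂ) - lam₁₂ ε * (x : ℂ)) *
          h₂ ((y : ℂ) - lam₁₂ ε * (x : ℂ))))
    (hJ : 1 + deriv f ((y : ℂ) - lam₀ * (x : ℂ)) * (x : ℂ) ≠ 0) :
    deriv lam₁₂ 0 =
      (1 + deriv f ((y : ℂ) - lam₀ * (x : ℂ)) * (x : ℂ)) *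
        deriv lam₁ 0 * deriv lam₂ 0 := by
  have e₁ := jacobian_mul_deriv_eq_of_implicit hU hf hh₁ hε₀ hd₁ himp₁
  have e₂ := jacobian_mul_deriv_eq_of_implicit hU hf hh₂ hε₀ hd₂ himp₂
  have e₁₂ := jacobian_mul_deriv_eq_of_implicit (h := fun z => h₁ z * h₂ z) hU hf
    (hh₁.mul hh₂) hε₀ hd₁₂ himp₁₂
  rw [h0₁] at e₁
  rw [h0₂] at e₂
  rw [h0₁₂] at e₁₂
  apply mul_left_cancel₀ hJ
  rw [e₁₂, ← e₁, ← e₂]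
  ring
end

section
/- Fix δ > 0 and define μ : {(x,y) ∈ ℝ² : x > −1} → ℂ by μ(x,y) = (−(x + i·y) + (δ − 1))/((x − i·y) + (δ + 1)) (the denominator is nonzero since its real part x + δ + 1 > δ > 0). Then μ satisfies the self-dilatation equation μ_z̄ = μ·μ_z on {x > −1}, where μ_z = (1/2)(μ_x − i·μ_y) and μ_z̄ = (1/2)(μ_x + i·μ_y). -/
/-- The δ-family Beltrami coefficient satisfies the
self-dilatation equation μ_z̄ = μ·μ_z. -/
theorem stmt_13 (δ : ℝ) (hδ : 0 < δ) (mu : ℝ × ℝ → ℂ)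
    (hmu : ∀ p : ℝ × ℝ,
      mu p = (-((p.1 : ℂ) + Complex.I * (p.2 : ℂ)) + ((δ : ℂ) - 1)) /
        (((p.1 : ℂ) - Complex.I * (p.2 : ℂ)) + ((δ : ℂ) + 1))) :
    ∀ p : ℝ × ℝ, -1 < p.1 →
      (1 / 2 : ℂ) * (fderiv ℝ mu p (1, 0) + Complex.I * fderiv ℝ mu p (0, 1)) =
        mu p *
          ((1 / 2 : ℂ) *
            (fderiv ℝ mu p (1, 0) - Complex.I * fderiv ℝ mu p (0, 1))) := by
  intro p hp
  have hD : ((p.1 : ℂ) - Complex.I * (p.2 : ℂ)) + ((δ : ℂ) + 1) ≠ 0 := by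
    intro h
    have hre := congrArg Complex.re h
    simp at hre
    linarith
  have hx : HasFDerivAt (fun q : ℝ × ℝ => (q.1 : ℂ))
      (Complex.ofRealCLM.comp (ContinuousLinearMap.fst ℝ ℝ ℝ)) p :=
    (Complex.ofRealCLM.comp (ContinuousLinearMap.fst ℝ ℝ ℝ)).hasFDerivAt
  have hy : HasFDerivAt (fun q : ℝ × ℝ => (q.2 : ℂ))
      (Complex.ofRealCLM.comp (ContinuousLinearMap.snd ℝ ℝ ℝ)) p :=
    (Complex.ofRealCLM.comp (ContinuousLinearMap.snd ℝ ℝ ℝ)).hasFDerivAt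
  have hnum := ((hx.fun_add (hy.const_mul Complex.I)).fun_neg).add_const ((δ : ℂ) - 1)
  have hden := (hx.fun_sub (hy.const_mul Complex.I)).add_const ((δ : ℂ) + 1)
  have hquot := hnum.fun_mul ((hasFDerivAt_inv' (𝕜 := ℝ) hD).comp p hden)
  have hmu' : mu = fun q => _ := funext fun q => (hmu q).trans (div_eq_mul_inv _ _)
  have hfderiv := (hquot.congr_of_eventuallyEq (Filter.EventuallyEq.of_eq hmu')).fderiv
  rw [hfderiv, hmu p]
  simp
  field_simp
  ring_nf
  simp [Complex.I_sq]
  ring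
end

section
/- Fix a real ε ≠ 0 and let Ω = {(x,y) ∈ ℝ² : ε²·y² < 4·(1 − ε·x)} (note this forces 1 − ε·x > 0). Define λ : Ω → ℂ by λ(x,y) = (−ε·y + i·√(4·(1 − ε·x) − ε²·y²))/(2·(1 − ε·x)), where √ denotes the real square root of the positive real number 4·(1 − ε·x) − ε²·y². Then Im λ > 0 on Ω and λ satisfies λ_x + λ·λ_y = 0 on Ω. -/
/-- The ε-family is elliptic and rigid on its parabolic domain. -/
theorem stmt_14 (ε : ℝ) (hε : ε ≠ 0)
    (Ω : Set (ℝ × ℝ)) (hΩ : Ω = {p : ℝ × ℝ | ε ^ 2 * p.2 ^ 2 < 4 * (1 - ε * p.1)})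
    (lam : ℝ × ℝ → ℂ)
    (hlam : ∀ p : ℝ × ℝ, lam p =
      (((-(ε * p.2) : ℝ) : ℂ) +
          Complex.I * ((Real.sqrt (4 * (1 - ε * p.1) - ε ^ 2 * p.2 ^ 2) : ℝ) : ℂ)) /
        (2 * (((1 - ε * p.1 : ℝ)) : ℂ))) :
    ∀ p ∈ Ω, 0 < (lam p).im ∧
      fderiv ℝ lam p (1, 0) + lam p * fderiv ℝ lam p (0, 1) = 0 := by
  obtain rfl : lam = _ := funext hlam
  subst hΩ
  rintro ⟨x, y⟩ hp
  simp only [Set.mem_ofPred_eq] at hp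
  have hD : 0 < 4 * (1 - ε * x) - ε ^ 2 * y ^ 2 := by linarith
  have ha : 0 < 1 - ε * x := by nlinarith [sq_nonneg (ε * y)]
  have hs := Real.sqrt_pos.2 hD
  have hsq := Real.sq_sqrt hD.le
  have haC : ((1 - ε * x : ℝ) : ℂ) ≠ 0 := by exact_mod_cast ha.ne'
  have hdiff : DifferentiableAt ℝ (fun p : ℝ × ℝ =>
      (((-(ε * p.2) : ℝ) : ℂ) +
          Complex.I * ((Real.sqrt (4 * (1 - ε * p.1) - ε ^ 2 * p.2 ^ 2) : ℝ) : ℂ)) /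
        (2 * (((1 - ε * p.1 : ℝ)) : ℂ))) (x, y) := by
    have h1 : DifferentiableAt ℝ (fun p : ℝ × ℝ => -(ε * p.2)) (x, y) := by fun_prop
    have h2 : DifferentiableAt ℝ
        (fun p : ℝ × ℝ => Real.sqrt (4 * (1 - ε * p.1) - ε ^ 2 * p.2 ^ 2)) (x, y) :=
      DifferentiableAt.sqrt (by fun_prop) hD.ne'
    have h3 : DifferentiableAt ℝ (fun p : ℝ × ℝ => 1 - ε * p.1) (x, y) := by fun_prop
    have c1 := Complex.ofRealCLM.differentiableAt.comp (x, y) h1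
    have c2 := Complex.ofRealCLM.differentiableAt.comp (x, y) h2
    have c3 := Complex.ofRealCLM.differentiableAt.comp (x, y) h3
    have hnum := c1.add (c2.const_mul Complex.I)
    have hden := c3.const_mul (2 : ℂ)
    have h := hnum.fun_mul (hden.fun_inv (mul_ne_zero two_ne_zero haC))
    simp only [div_eq_mul_inv]
    exact h
  refine ⟨?_, ?_⟩
  · have him : ((((-(ε * y) : ℝ) : ℂ) +
          Complex.I * ((Real.sqrt (4 * (1 - ε * x) - ε ^ 2 * y ^ 2) : ℝ) : ℂ)) /
        (2 * (((1 - ε * x : ℝ)) : ℂ))).im =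
        Real.sqrt (4 * (1 - ε * x) - ε ^ 2 * y ^ 2) / (2 * (1 - ε * x)) := by
      rw [show (2 * ((1 - ε * x : ℝ) : ℂ)) = ((2 * (1 - ε * x) : ℝ) : ℂ) by push_cast; ring,
        Complex.div_ofReal_im]
      simp only [Complex.add_im, Complex.ofReal_im, Complex.I_mul_im, Complex.ofReal_re, zero_add]
    exact him ▸ by positivity
  · have ex := hdiff.hasFDerivAt.comp_hasDerivAt x
      ((hasDerivAt_id x).prodMk (hasDerivAt_const x y))
    have ey := hdiff.hasFDerivAt.comp_hasDerivAt y
      ((hasDerivAt_const y x).prodMk (hasDerivAt_id y))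
    have ax : HasDerivAt (fun t : ℝ => 1 - ε * t) (-ε) x := by
      simpa using ((hasDerivAt_id x).const_mul ε).const_sub 1
    have sx := (((ax.const_mul 4).sub_const (ε ^ 2 * y ^ 2)).sqrt hD.ne').ofReal_comp
    have dx := ((sx.const_mul Complex.I).const_add ((-(ε * y) : ℝ) : ℂ)).fun_div
      (ax.ofReal_comp.const_mul 2) (mul_ne_zero two_ne_zero haC)
    have ny : HasDerivAt (fun t : ℝ => -(ε * t)) (-ε) y := by
      simpa using ((hasDerivAt_id y).const_mul ε).fun_neg
    have sy := (((((hasDerivAt_id y).pow 2).const_mul (ε ^ 2)).const_sub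
      (4 * (1 - ε * x))).sqrt hD.ne').ofReal_comp
    have dy := (ny.ofReal_comp.add (sy.const_mul Complex.I)).div_const
      (2 * ((1 - ε * x : ℝ) : ℂ))
    rw [ex.unique dx, ey.unique dy]
    simp only [id, Pi.pow_apply]
    generalize Real.sqrt (4 * (1 - ε * x) - ε ^ 2 * y ^ 2) = s at hs hsq ⊢
    have hsC : (s : ℂ) ≠ 0 := by exact_mod_cast hs.ne'
    have hsqC : (s : ℂ) ^ 2 = 4 * (1 - ε * x) - ε ^ 2 * y ^ 2 := by exact_mod_cast hsq
    push_cast at haC ⊢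
    field_simp
    linear_combination (Complex.I * ε) * hsqC - (ε : ℂ) ^ 2 * s * y * Complex.I_sq
end

section
/- Fix δ > 0 and let (x,y) ∈ ℝ² with x ≠ 0. Then there exists λ ∈ ℂ satisfying simultaneously the Cauchy-kernel quadratic x·λ² − (y + i·δ)·λ − 1 = 0 and the Jacobian vanishing condition 1 + λ²·x = 0 if and only if x = δ²/4 and y = 0. (Hence the shock locus of the Burgers transform of the seed f(ξ) = −1/(ξ + i·δ) is the single isolated point (δ²/4, 0).) -/
/-- The shock locus of the Cauchy-kernel seed is the single
point (δ²/4, 0). -/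
theorem stmt_17 (δ : ℝ) (hδ : 0 < δ) (x y : ℝ) (hx : x ≠ 0) :
    (∃ lam : ℂ, (x : ℂ) * lam ^ 2 - ((y : ℂ) + Complex.I * (δ : ℂ)) * lam - 1 = 0 ∧
        1 + lam ^ 2 * (x : ℂ) = 0) ↔ (x = δ ^ 2 / 4 ∧ y = 0) := by
  constructor
  · rintro ⟨lam, h₁, h₂⟩
    have hlin : ((y : ℂ) + Complex.I * δ) * lam = -2 := by linear_combination h₂ - h₁
    have hdisc : ((y : ℂ) + Complex.I * δ) ^ 2 + 4 * x = 0 := by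
      linear_combination ((y : ℂ) + Complex.I * δ) ^ 2 * h₂ -
        x * (((y : ℂ) + Complex.I * δ) * lam - 2) * hlin
    have hre := congrArg Complex.re hdisc
    have him := congrArg Complex.im hdisc
    simp [pow_two] at hre him
    have hy : y = 0 := by
      have : δ * y = 0 := by linarith
      exact (mul_eq_zero.mp this).resolve_left hδ.ne'
    subst hy
    exact ⟨by linarith, rfl⟩
  · rintro ⟨rfl, rfl⟩
    have hδ' : (δ : ℂ) ≠ 0 := by exact_mod_cast hδ.ne'
    refine ⟨2 * Complex.I / δ, ?_, ?_⟩
    · push_cast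
      field_simp
      linear_combination (-4 * δ : ℂ) * Complex.I_sq
    · push_cast
      field_simp
      linear_combination 4 * Complex.I_sq
end
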